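/- arXiv:2007.06399 — 2 statements merged into one kernel-verified Lean document; each statement's English description precedes it below -/
import Mathlib

section
/- Let G be a connected simple graph. Then G admits a strong orientation (an orientation in which every vertex is reachable from every other vertex by a directed path) if and only if G has no bridge. -/
open SimpleGraph

variable {V : Type*}

/-- `D` is an orientation of `G`: every arc of `D` is an edge of `G`, and every edge of `G`
receives exactly one of the two possible directions. -/
def IsOrientation (G : SimpleGraph V) (D : V → V → Prop) : Prop :=
  (∀ u v, D u v → G.Adj u v) ∧ ∀ u v, G.Adj u v → (D u v ↔ ¬ D v u)

/-- There is a directed walk of length `n` from `u` to `v` in the digraph `D`. -/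
def DPath (D : V → V → Prop) : ℕ → V → V → Prop
  | 0, u, v => u = v
  | n + 1, u, v => ∃ w, D u w ∧ DPath D n w v

/-- Directed distance from `u` to `v` (`⊤` if `v` is not reachable from `u`). -/
noncomputable def ddist (D : V → V → Prop) (u v : V) : ℕ∞ :=
  sInf {n : ℕ∞ | ∃ m : ℕ, n = (m : ℕ∞) ∧ DPath D m u v}

/-- Diameter of a digraph: supremum of directed distances over all ordered pairs. -/
noncomputable def odiam (D : V → V → Prop) : ℕ∞ :=
  ⨆ u : V, ⨆ v : V, ddist D u v

/-- A strong orientation of `G`: an orientation in which every vertex is reachable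
from every other vertex by a directed path. -/
def IsStrongOrientation (G : SimpleGraph V) (D : V → V → Prop) : Prop :=
  IsOrientation G D ∧ ∀ u v, ∃ m : ℕ, DPath D m u v

/-- The orientation number of `G`: minimum diameter over all strong orientations. -/
noncomputable def orientNum (G : SimpleGraph V) : ℕ∞ :=
  sInf {d : ℕ∞ | ∃ D : V → V → Prop, IsStrongOrientation G D ∧ d = odiam D}

/-- The vertex-multiplication `G(s)`: vertex `v` is replaced by `s v` copies, and copies of
`v_i`, `v_j` are adjacent iff `v_i v_j` is an edge of `G` (whence `i ≠ j`). -/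
def vertexMult (G : SimpleGraph V) (s : V → ℕ) : SimpleGraph (Σ v : V, Fin (s v)) where
  Adj x y := G.Adj x.1 y.1
  symm := ⟨fun _ _ h => G.adj_symm h⟩
  loopless := ⟨fun x h => G.loopless.irrefl x.1 h⟩

/-- Eccentricity of a vertex. -/
noncomputable def ecc (G : SimpleGraph V) (v : V) : ℕ∞ :=
  ⨆ u : V, G.edist v u

open Relation

theorem reflTransGen_of_dPath {D : V → V → Prop} {n : ℕ} {u v : V} (h : DPath D n u v) :
    ReflTransGen D u v := by
  induction n generalizing u with
  | zero => exact h ▸ .refl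
  | succ n ih =>
    obtain ⟨w, huw, hwv⟩ := h
    exact .head huw (ih hwv)

theorem exists_dPath_of_reflTransGen {D : V → V → Prop} {u v : V} (h : ReflTransGen D u v) :
    ∃ n, DPath D n u v := by
  induction h using ReflTransGen.head_induction_on with
  | refl => exact ⟨0, rfl⟩
  | head huw _ ih =>
    obtain ⟨n, hn⟩ := ih
    exact ⟨n + 1, _, huw, hn⟩

/-- Every edge of a strongly oriented graph can be bypassed by a directed path. -/
theorem IsStrongOrientation.reachable_deleteEdges {G : SimpleGraph V} {D : V → V → Prop}
    (h : IsStrongOrientation G D) {u v : V} (huv : D u v) :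
    (G.deleteEdges {s(u, v)}).Reachable v u := by
  obtain ⟨⟨hadj, hone⟩, hreach⟩ := h
  have key : ∀ {x}, ReflTransGen D x u → (G.deleteEdges {s(u, v)}).Reachable x u := by
    intro x hx
    induction hx using ReflTransGen.head_induction_on with
    | refl => exact .rfl
    | @head x w hxw _ ih =>
      by_cases he : s(x, w) = s(u, v)
      · rcases Sym2.eq_iff.1 he with ⟨rfl, rfl⟩ | ⟨rfl, rfl⟩
        · exact .rfl
        · exact absurd hxw ((hone _ _ (hadj _ _ huv)).1 huv)
      · refine Reachable.trans (Adj.reachable ?_) ih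
        rw [deleteEdges_adj]
        exact ⟨hadj _ _ hxw, he⟩
  obtain ⟨n, hn⟩ := hreach v u
  exact key (reflTransGen_of_dPath hn)

/-- A partial orientation of `G` in which every arc lies on a closed directed walk. -/
structure IsCyclicPartialOrientation (G : SimpleGraph V) (D : V → V → Prop) : Prop where
  adj : ∀ u v, D u v → G.Adj u v
  asymm : ∀ u v, D u v → ¬ D v u
  back : ∀ u v, D u v → ReflTransGen D v u

theorem exists_maximal_isCyclicPartialOrientation (G : SimpleGraph V) :
    ∃ D, Maximal (IsCyclicPartialOrientation G) D := by
  refine (zorn_le_nonempty₀ {D | IsCyclicPartialOrientation G D} (fun c hc hchain _ _ ↦ ?_)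
    (fun _ _ ↦ False) ⟨by simp, by simp, by simp⟩).imp fun _ h ↦ h.2
  refine ⟨fun u v ↦ ∃ D ∈ c, D u v, ⟨?_, ?_, ?_⟩, fun D hD u v huv ↦ ⟨D, hD, huv⟩⟩
  · rintro u v ⟨D, hD, huv⟩
    exact (hc hD).adj u v huv
  · rintro u v ⟨D, hD, huv⟩ ⟨D', hD', hvu⟩
    rcases hchain.total hD hD' with hle | hle
    · exact (hc hD').asymm u v (hle u v huv) hvu
    · exact (hc hD).asymm u v huv (hle v u hvu)
  · rintro u v ⟨D, hD, huv⟩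
    exact ReflTransGen.mono (fun a b hab ↦ ⟨D, hD, hab⟩) _ _ ((hc hD).back u v huv)

theorem SimpleGraph.Walk.reflTransGen_of_darts {G : SimpleGraph V} {R : V → V → Prop} {u v : V}
    (p : G.Walk u v) (h : ∀ d ∈ p.darts, ReflTransGen R d.fst d.snd) : ReflTransGen R u v := by
  induction p with
  | nil => exact .refl
  | cons hadj p ih =>
    simp only [Walk.darts_cons, List.forall_mem_cons] at h
    exact h.1.trans (ih h.2)

theorem SimpleGraph.Walk.reflTransGen_of_mem_darts {G : SimpleGraph V} {R : V → V → Prop}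
    {u v : V} (p : G.Walk u v) (h : ∀ d ∈ p.darts, ReflTransGen R d.fst d.snd) {d : G.Dart}
    (hd : d ∈ p.darts) : ReflTransGen R u d.fst ∧ ReflTransGen R d.snd v := by
  induction p with
  | nil => simp at hd
  | cons hadj p ih =>
    simp only [Walk.darts_cons, List.forall_mem_cons] at h
    rcases List.mem_cons.1 hd with rfl | hd
    · exact ⟨.refl, p.reflTransGen_of_darts h.2⟩
    · exact ⟨h.1.trans (ih h.2 hd).1, (ih h.2 hd).2⟩

theorem SimpleGraph.Walk.IsTrail.symm_notMem_darts {G : SimpleGraph V} {u v : V}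
    {p : G.Walk u v} (hp : p.IsTrail) {d : G.Dart} (hd : d ∈ p.darts) : d.symm ∉ p.darts :=
  fun hd' ↦ d.symm_ne (List.inj_on_of_nodup_map hp.edges_nodup hd' hd d.edge_symm)

/-- A cyclic partial orientation that misses a non-bridge edge extends to one containing it:
orient the missing edges of a cycle through it consistently. -/
theorem IsCyclicPartialOrientation.exists_extension {G : SimpleGraph V} {D : V → V → Prop}
    (hD : IsCyclicPartialOrientation G D) {u v : V} (huv : G.Adj u v) (hnuv : ¬ D u v)
    (hnvu : ¬ D v u) (hbr : ¬ G.IsBridge s(u, v)) :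
    ∃ D', IsCyclicPartialOrientation G D' ∧ D ≤ D' ∧ D' u v := by
  rw [isBridge_iff, not_not] at hbr
  obtain ⟨p, hp⟩ := hbr.symm.exists_isPath
  let N : V → V → Prop := fun a b ↦
    (∃ d ∈ p.darts, d.fst = a ∧ d.snd = b) ∧ ¬ D a b ∧ ¬ D b a
  let D' : V → V → Prop := fun a b ↦ D a b ∨ N a b ∨ (a = u ∧ b = v)
  have hle : ∀ {a b}, ReflTransGen D a b → ReflTransGen D' a b :=
    ReflTransGen.mono (fun _ _ ↦ Or.inl) _ _
  have hstep : ∀ d ∈ p.darts, ReflTransGen D' d.fst d.snd := by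
    intro d hd
    by_cases h₁ : D d.fst d.snd
    · exact .single (.inl h₁)
    by_cases h₂ : D d.snd d.fst
    · exact hle (hD.back _ _ h₂)
    · exact .single (.inr (.inl ⟨⟨d, hd, rfl, rfl⟩, h₁, h₂⟩))
  have hnew : D' u v := .inr (.inr ⟨rfl, rfl⟩)
  have hedge : ∀ d ∈ p.darts, s(d.fst, d.snd) ≠ s(u, v) := fun d _ ↦
    ((deleteEdges_adj ..).1 d.adj).2
  refine ⟨D', ⟨?_, ?_, ?_⟩, fun _ _ ↦ Or.inl, hnew⟩
  · rintro a b (h | ⟨⟨d, -, rfl, rfl⟩, -⟩ | ⟨rfl, rfl⟩)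
    · exact hD.adj a b h
    · exact deleteEdges_le _ d.adj
    · exact huv
  · rintro a b (h | ⟨⟨d, hd, rfl, rfl⟩, h₁, h₂⟩ | ⟨rfl, rfl⟩)
      (h' | ⟨⟨d', hd', ha, hb⟩, h₁', h₂'⟩ | ⟨ha, hb⟩)
    · exact hD.asymm a b h h'
    · exact h₂' h
    · subst ha hb
      exact hnvu h
    · exact h₂ h'
    · have : d' = d.symm := Dart.ext _ _ (Prod.ext ha hb)
      exact hp.isTrail.symm_notMem_darts hd (this ▸ hd')
    · exact hedge d hd (by rw [ha, hb, Sym2.eq_swap])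
    · exact hnvu h'
    · exact hedge d' hd' (by rw [ha, hb, Sym2.eq_swap])
    · exact huv.ne hb
  · rintro a b (h | ⟨⟨d, hd, rfl, rfl⟩, -⟩ | ⟨rfl, rfl⟩)
    · exact hle (hD.back a b h)
    · obtain ⟨h₁, h₂⟩ := p.reflTransGen_of_mem_darts hstep hd
      exact h₂.trans (.head hnew h₁)
    · exact p.reflTransGen_of_darts hstep

theorem stmt0 (G : SimpleGraph V) (hG : G.Connected) :
    (∃ D : V → V → Prop, IsStrongOrientation G D) ↔ ∀ e ∈ G.edgeSet, ¬ G.IsBridge e := by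
  constructor
  · rintro ⟨D, hD⟩ e he hbr
    induction e with | h u v
    rw [isBridge_iff] at hbr
    by_cases huv : D u v
    · exact hbr (hD.reachable_deleteEdges huv).symm
    · have hvu : D v u := by
        by_contra hvu
        exact huv ((hD.1.2 u v he).2 hvu)
      exact hbr (Sym2.eq_swap ▸ hD.reachable_deleteEdges hvu)
  · intro hbr
    obtain ⟨D, hD, hmax⟩ := exists_maximal_isCyclicPartialOrientation G
    have htotal : ∀ u v, G.Adj u v → ¬ D v u → D u v := by
      intro u v huv hnvu
      by_contra hnuv
      obtain ⟨D', hD', hle, h⟩ := hD.exists_extension huv hnuv hnvu (hbr s(u, v) huv)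
      exact hnuv (hmax hD' hle u v h)
    refine ⟨D, ⟨hD.adj, fun u v huv ↦ ⟨hD.asymm u v, htotal u v huv⟩⟩, fun u v ↦ ?_⟩
    obtain ⟨p⟩ := hG.preconnected u v
    refine exists_dPath_of_reflTransGen (p.reflTransGen_of_darts fun d _ ↦ ?_)
    by_cases h : D d.snd d.fst
    · exact hD.back _ _ h
    · exact .single (htotal _ _ d.adj h)
end

section
/- Let T be a tree of diameter 5 with vertex set {v_1, ..., v_n}, and let s_1, ..., s_n be integers with s_i ≥ 2 for all i. Let A = {x ∈ V(T) : there exist distinct vertices u, v ∈ V(T) with d_T(x, u) = 5 and d_T(x, v) = 5}. If |A| ≤ 1, then d̄(T(s_1, ..., s_n)) = 5; that is, T(s_1, ..., s_n) belongs to class C_0. -/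
open SimpleGraph

variable {V : Type*}

section TreeDistance

variable {T : SimpleGraph V}

lemma SimpleGraph.IsAcyclic.length_eq_dist (hT : T.IsAcyclic) {u v : V} (p : T.Walk u v)
    (hp : p.IsPath) : p.length = T.dist u v := by
  obtain ⟨g, hg⟩ := p.reachable.exists_walk_length_eq_dist
  have := (hT.subsingleton_path u v).elim ⟨p, hp⟩ ⟨g, g.isPath_of_length_eq_dist hg⟩
  rw [← hg, Subtype.mk.inj this]

lemma SimpleGraph.Walk.dist_add_dist_of_length_eq_dist {u v t : V} (p : T.Walk u v)
    (hp : p.length = T.dist u v) (ht : t ∈ p.support) :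
    T.dist u t + T.dist t v ≤ T.dist u v := by
  classical
  have h := congrArg Walk.length (p.take_spec ht)
  rw [Walk.length_append] at h
  have h1 := dist_le (p.takeUntil t ht)
  have h2 := dist_le (p.dropUntil t ht)
  omega

/-- In a tree, the distance between vertices on different sides of an edge `ab` is measured
through that edge. -/
lemma SimpleGraph.IsTree.dist_eq_of_adj (hT : T.IsTree) {a b w z : V} (hab : T.Adj a b)
    (hw : T.dist w a < T.dist w b) (hz : T.dist z b < T.dist z a) :
    T.dist w z = T.dist w a + 1 + T.dist z b := by
  obtain ⟨p, hp⟩ := hT.connected.exists_walk_length_eq_dist w a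
  obtain ⟨q, hq⟩ := hT.connected.exists_walk_length_eq_dist b z
  have hpath : (p.append (Walk.cons hab q)).IsPath := by
    rw [Walk.isPath_def, Walk.support_append, Walk.support_cons, List.tail_cons,
      List.nodup_append']
    refine ⟨(p.isPath_of_length_eq_dist hp).support_nodup,
      (q.isPath_of_length_eq_dist hq).support_nodup, fun t htp htq => ?_⟩
    have h1 := p.dist_add_dist_of_length_eq_dist hp htp
    have h2 := q.dist_add_dist_of_length_eq_dist hq htq
    have h3 := hT.connected.dist_triangle (u := w) (v := t) (w := b)
    have h4 := hT.connected.dist_triangle (u := z) (v := t) (w := a)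
    rw [T.dist_comm (u := b) (v := t), T.dist_comm (u := t) (v := z),
      T.dist_comm (u := b) (v := z)] at h2
    omega
  have := hT.isAcyclic.length_eq_dist _ hpath
  rw [Walk.length_append, Walk.length_cons, hp, hq, T.dist_comm (u := b)] at this
  omega

end TreeDistance

section DirectedWalks

variable {D : V → V → Prop}

lemma DPath.single {u v : V} (h : D u v) : DPath D 1 u v := ⟨v, h, rfl⟩

lemma DPath.trans {m n : ℕ} {u v w : V} (h : DPath D m u v) (h' : DPath D n v w) :
    DPath D (m + n) u w := by
  induction m generalizing u with
  | zero => cases h; simpa using h'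
  | succ m ih =>
    obtain ⟨t, ht, htv⟩ := h
    rw [Nat.succ_add]
    exact ⟨t, ht, ih htv⟩

lemma DPath.comap {W : Type*} {f : W → V} (hf : Function.Surjective f) {m : ℕ} {x y : W}
    (h : DPath D (m + 1) (f x) (f y)) :
    DPath (fun x y => D (f x) (f y)) (m + 1) x y := by
  induction m generalizing x with
  | zero =>
    obtain ⟨t, ht, rfl⟩ := h
    exact .single ht
  | succ m ih =>
    obtain ⟨t, ht, hty⟩ := h
    obtain ⟨z, rfl⟩ := hf t
    exact ⟨z, ht, ih hty⟩

lemma ddist_le {m : ℕ} {u v : V} (h : DPath D m u v) : ddist D u v ≤ m :=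
  sInf_le ⟨m, rfl, h⟩

lemma IsOrientation.edist_le_of_dPath {T : SimpleGraph V} {s : V → ℕ}
    {D : (Σ v, Fin (s v)) → (Σ v, Fin (s v)) → Prop} (hD : IsOrientation (vertexMult T s) D)
    {m : ℕ} {x y : Σ v, Fin (s v)} (h : DPath D m x y) : T.edist x.1 y.1 ≤ m := by
  suffices ∃ p : T.Walk x.1 y.1, p.length = m by
    obtain ⟨p, rfl⟩ := this
    exact edist_le p
  induction m generalizing x with
  | zero => cases h; exact ⟨.nil, rfl⟩
  | succ m ih =>
    obtain ⟨t, ht, hty⟩ := h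
    obtain ⟨p, rfl⟩ := ih hty
    exact ⟨.cons (hD.1 _ _ ht) p, rfl⟩

lemma IsOrientation.ediam_le_odiam {T : SimpleGraph V} {s : V → ℕ} (hs : ∀ v, 0 < s v)
    {D : (Σ v, Fin (s v)) → (Σ v, Fin (s v)) → Prop} (hD : IsOrientation (vertexMult T s) D) :
    T.ediam ≤ odiam D := by
  refine ediam_le_of_edist_le fun u v => ?_
  refine le_trans ?_ (le_iSup₂ (f := fun x y => ddist D x y) ⟨u, 0, hs u⟩ ⟨v, 0, hs v⟩)
  refine le_sInf ?_
  rintro _ ⟨m, rfl, hm⟩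
  exact hD.edist_le_of_dPath hm

end DirectedWalks

/-- A homomorphism `k` from `T` onto the path `0 - 1 - 2 - 3 - 4 - 5` whose fibres over `0`, `2`
and `3` are the singletons `{x}`, `{a}` and `{b}`, with all of fibre `1` adjacent to `a` and all
of fibre `4` adjacent to `b`. -/
structure IsLevelMap (T : SimpleGraph V) (k : V → ℕ) (x p a b : V) : Prop where
  le_five : ∀ v, k v ≤ 5
  adj : ∀ u v, T.Adj u v → k u = k v + 1 ∨ k v = k u + 1
  eq_zero : ∀ v, k v = 0 ↔ v = x
  eq_two : ∀ v, k v = 2 ↔ v = a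
  eq_three : ∀ v, k v = 3 ↔ v = b
  one_p : k p = 1
  adj_xp : T.Adj x p
  adj_a : ∀ v, k v = 1 → T.Adj v a
  adj_ab : T.Adj a b
  adj_b : ∀ v, k v = 4 → T.Adj v b
  exists_parent : ∀ v, k v = 5 → ∃ r, k r = 4 ∧ T.Adj v r

lemma SimpleGraph.IsTree.exists_isLevelMap {T : SimpleGraph V} (hT : T.IsTree) {a b x : V}
    (hab : T.Adj a b) (ha : ∀ w, T.dist w a < T.dist w b → T.dist w a ≤ 2)
    (hb : ∀ w, T.dist w b < T.dist w a → T.dist w b ≤ 2)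
    (hx : T.dist x a < T.dist x b) (hxa : T.dist x a = 2)
    (huniq : ∀ w, T.dist w a < T.dist w b → T.dist w a = 2 → w = x) :
    ∃ k p, IsLevelMap T k x p a b := by
  have hne (w) : T.dist w a ≠ T.dist w b := hT.dist_ne_of_adj w hab
  have hnontriv : Nontrivial V := ⟨a, b, hab.ne⟩
  have hzero (u v : V) : T.dist u v = 0 ↔ u = v := hT.connected.dist_eq_zero_iff
  have hself (u : V) : T.dist u u = 0 := dist_self
  have hab1 : T.dist a b = 1 := dist_eq_one_iff_adj.2 hab
  have hba1 : T.dist b a = 1 := dist_eq_one_iff_adj.2 hab.symm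
  let k : V → ℕ := fun w => if T.dist w a < T.dist w b then 2 - T.dist w a else 3 + T.dist w b
  have hkA {w} (h : T.dist w a < T.dist w b) : k w = 2 - T.dist w a := if_pos h
  have hkB {w} (h : T.dist w b < T.dist w a) : k w = 3 + T.dist w b := if_neg h.not_gt
  have hside (w) : T.dist w a < T.dist w b ∨ T.dist w b < T.dist w a := lt_or_gt_of_ne (hne w)
  have hcross {u v} (h : T.Adj u v) (hu : T.dist u a < T.dist u b)
      (hv : T.dist v b < T.dist v a) : k v = k u + 1 := by
    have h1 := hT.dist_eq_of_adj hab hu hv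
    rw [dist_eq_one_iff_adj.2 h] at h1
    rw [hkA hu, hkB hv]
    omega
  have hadj (u v) (h : T.Adj u v) : k u = k v + 1 ∨ k v = k u + 1 := by
    have h1 := hT.dist_eq_dist_add_one_of_adj a h
    have h2 := hT.dist_eq_dist_add_one_of_adj b h
    simp only [T.dist_comm (u := a), T.dist_comm (u := b)] at h1 h2
    rcases hside u with hu | hu <;> rcases hside v with hv | hv
    · have := ha u hu
      have := ha v hv
      rw [hkA hu, hkA hv]
      omega
    · exact .inr (hcross h hu hv)
    · exact .inl (hcross h.symm hv hu)
    · rw [hkB hu, hkB hv]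
      omega
  have hle (v) : k v ≤ 5 := by
    rcases hside v with hv | hv
    · rw [hkA hv]; omega
    · have := hb v hv
      rw [hkB hv]; omega
  have hkx : k x = 0 := by rw [hkA hx, hxa]
  obtain ⟨p, hp⟩ := hT.connected.preconnected.exists_adj_of_nontrivial x
  refine ⟨k, p, hle, hadj, fun v => ⟨fun h => ?_, ?_⟩, fun v => ⟨fun h => ?_, ?_⟩,
    fun v => ⟨fun h => ?_, ?_⟩, ?_, hp, fun v h => ?_, hab, fun v h => ?_, fun v h => ?_⟩
  · rcases hside v with hv | hv
    · have := ha v hv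
      rw [hkA hv] at h
      exact huniq v hv (by omega)
    · rw [hkB hv] at h; omega
  · rintro rfl; exact hkx
  · rcases hside v with hv | hv
    · have := ha v hv
      rw [hkA hv] at h
      exact (hzero v a).1 (by omega)
    · rw [hkB hv] at h; omega
  · rintro rfl
    have := hself v
    rw [hkA (by omega), this]
  · rcases hside v with hv | hv
    · rw [hkA hv] at h; omega
    · rw [hkB hv] at h
      exact (hzero v b).1 (by omega)
  · rintro rfl
    have := hself v
    rw [hkB (by omega), this]
  · have := hadj _ _ hp
    omega
  · rcases hside v with hv | hv
    · rw [hkA hv] at h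
      exact dist_eq_one_iff_adj.1 (by omega)
    · rw [hkB hv] at h; omega
  · rcases hside v with hv | hv
    · rw [hkA hv] at h; omega
    · rw [hkB hv] at h
      exact dist_eq_one_iff_adj.1 (by omega)
  · obtain ⟨r, hr⟩ := hT.connected.preconnected.exists_adj_of_nontrivial v
    have := hadj _ _ hr
    have := hle r
    exact ⟨r, by omega, hr⟩

/-- The direction of the edge between copy class `c` of a vertex of level `i` and copy class `e`
of a vertex of level `i + 1`: `true` means towards the higher level. -/
def upward : ℕ → Bool → Bool → Bool
  | 0, c, e => c == e
  | 1, _, e => e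
  | 2, c, _ => c
  | 3, c, e => c != e
  | _, c, _ => !c

/-- The orientation of the multiplication of `T` by two determined by `upward` and a level
map `k`. -/
def levelOrientation (T : SimpleGraph V) (k : V → ℕ) (u v : V × Bool) : Prop :=
  T.Adj u.1 v.1 ∧ ((k v.1 = k u.1 + 1 ∧ upward (k u.1) u.2 v.2 = true) ∨
    (k u.1 = k v.1 + 1 ∧ upward (k v.1) v.2 u.2 = false))

/-- Length of a directed walk from copy class `c` of a vertex of level `i` to copy class `d` of
the vertex of level `3`. -/
def lengthTo (i : ℕ) (c d : Bool) : ℕ :=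
  match i with
  | 0 => 3
  | 1 => 2
  | 2 => if c then 1 else 3
  | 3 => if c = d then 0 else 4
  | 4 => if c = d then 1 else 3
  | _ => if d then 2 else 4

/-- Length of a directed walk from copy class `d` of the vertex of level `3` to copy class `c` of
a vertex of level `i`. -/
def lengthFrom (i : ℕ) (d c : Bool) : ℕ :=
  match i with
  | 0 => 3
  | 1 => 2
  | 2 => if c then 3 else 1
  | 3 => if c = d then 0 else 4
  | 4 => if c = d then 3 else 1
  | _ => if d then 2 else 4

namespace IsLevelMap

variable {T : SimpleGraph V} {k : V → ℕ} {x p a b : V}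

lemma levelOrientation_iff_not (h : IsLevelMap T k x p a b) {u v : V × Bool}
    (huv : T.Adj u.1 v.1) : levelOrientation T k u v ↔ ¬ levelOrientation T k v u := by
  have h1 := h.adj _ _ huv
  simp only [levelOrientation, huv, huv.symm, true_and]
  rcases h1 with h1 | h1
  · have h2 : k v.1 ≠ k u.1 + 1 := by omega
    simp only [h1, h1 ▸ h2, true_and, false_and, false_or, or_false, Bool.not_eq_true]
  · have h2 : k u.1 ≠ k v.1 + 1 := by omega
    simp only [h1, h1 ▸ h2, true_and, false_and, false_or, or_false, Bool.not_eq_false]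

lemma two_a (h : IsLevelMap T k x p a b) : k a = 2 := (h.eq_two a).2 rfl

lemma three_b (h : IsLevelMap T k x p a b) : k b = 3 := (h.eq_three b).2 rfl

lemma zero_x (h : IsLevelMap T k x p a b) : k x = 0 := (h.eq_zero x).2 rfl

lemma arc_up {u v : V} (huv : T.Adj u v) {i : ℕ} (hu : k u = i)
    (hv : k v = i + 1) {c e : Bool} (hce : upward i c e = true) :
    DPath (levelOrientation T k) 1 (u, c) (v, e) :=
  .single ⟨huv, .inl ⟨by simp [hu, hv], by simpa [hu] using hce⟩⟩

lemma arc_down {u v : V} (huv : T.Adj u v) {i : ℕ} (hu : k u = i)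
    (hv : k v = i + 1) {c e : Bool} (hce : upward i c e = false) :
    DPath (levelOrientation T k) 1 (v, e) (u, c) :=
  .single ⟨huv.symm, .inr ⟨by simp [hu, hv], by simpa [hu] using hce⟩⟩

lemma arc_xp (h : IsLevelMap T k x p a b) (c : Bool) :
    DPath (levelOrientation T k) 1 (x, c) (p, c) :=
  arc_up h.adj_xp h.zero_x h.one_p (by simp [upward])

lemma arc_px (h : IsLevelMap T k x p a b) (c : Bool) :
    DPath (levelOrientation T k) 1 (p, !c) (x, c) :=
  arc_down h.adj_xp h.zero_x h.one_p (by simp [upward])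

lemma arc_to_a (h : IsLevelMap T k x p a b) {q : V} (hq : k q = 1) (c : Bool) :
    DPath (levelOrientation T k) 1 (q, c) (a, true) :=
  arc_up (h.adj_a q hq) hq h.two_a rfl

lemma arc_from_a (h : IsLevelMap T k x p a b) {q : V} (hq : k q = 1) (c : Bool) :
    DPath (levelOrientation T k) 1 (a, false) (q, c) :=
  arc_down (h.adj_a q hq) hq h.two_a rfl

lemma arc_ab (h : IsLevelMap T k x p a b) (c : Bool) :
    DPath (levelOrientation T k) 1 (a, true) (b, c) :=
  arc_up h.adj_ab h.two_a h.three_b rfl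

lemma arc_ba (h : IsLevelMap T k x p a b) (c : Bool) :
    DPath (levelOrientation T k) 1 (b, c) (a, false) :=
  arc_down h.adj_ab h.two_a h.three_b rfl

lemma arc_to_b (h : IsLevelMap T k x p a b) {r : V} (hr : k r = 4) (c : Bool) :
    DPath (levelOrientation T k) 1 (r, c) (b, c) :=
  arc_down (h.adj_b r hr).symm h.three_b hr (by simp [upward])

lemma arc_from_b (h : IsLevelMap T k x p a b) {r : V} (hr : k r = 4) (c : Bool) :
    DPath (levelOrientation T k) 1 (b, !c) (r, c) :=
  arc_up (h.adj_b r hr).symm h.three_b hr (by simp [upward])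

lemma dPath_a_a (h : IsLevelMap T k x p a b) :
    DPath (levelOrientation T k) 2 (a, false) (a, true) :=
  (h.arc_from_a h.one_p true).trans (h.arc_to_a h.one_p true)

lemma dPath_b_b (h : IsLevelMap T k x p a b) (c d : Bool) :
    DPath (levelOrientation T k) 4 (b, c) (b, d) :=
  ((h.arc_ba c).trans h.dPath_a_a).trans (h.arc_ab d)

lemma dPath_r_b (h : IsLevelMap T k x p a b) {r : V} (hr : k r = 4) (c : Bool) :
    DPath (levelOrientation T k) 3 (r, !c) (b, c) := by
  have h1 := h.arc_from_b hr c
  exact ((h.arc_to_b hr (!c)).trans h1).trans (h.arc_to_b hr c)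

lemma dPath_b_r (h : IsLevelMap T k x p a b) {r : V} (hr : k r = 4) (c : Bool) :
    DPath (levelOrientation T k) 3 (b, c) (r, c) := by
  have h1 := h.arc_from_b hr (!c)
  rw [Bool.not_not] at h1
  exact (h1.trans (h.arc_to_b hr (!c))).trans (h.arc_from_b hr c)

lemma dPath_to_b (h : IsLevelMap T k x p a b) (u : V) (c d : Bool) :
    DPath (levelOrientation T k) (lengthTo (k u) c d) (u, c) (b, d) := by
  have hle := h.le_five u
  generalize hi : k u = i at hle
  interval_cases i
  · obtain rfl := (h.eq_zero u).1 hi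
    exact ((h.arc_xp c).trans (h.arc_to_a h.one_p c)).trans (h.arc_ab d)
  · exact (h.arc_to_a hi c).trans (h.arc_ab d)
  · obtain rfl := (h.eq_two u).1 hi
    cases c
    · exact h.dPath_a_a.trans (h.arc_ab d)
    · exact h.arc_ab d
  · obtain rfl := (h.eq_three u).1 hi
    by_cases hcd : c = d
    · subst hcd; simp [lengthTo, DPath]
    · simpa [lengthTo, hcd] using h.dPath_b_b c d
  · by_cases hcd : c = d
    · subst hcd; simpa [lengthTo] using h.arc_to_b hi c
    · obtain rfl : c = !d := Bool.eq_not_of_ne hcd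
      simpa [lengthTo] using h.dPath_r_b hi d
  · obtain ⟨r, hr, hur⟩ := h.exists_parent u hi
    have h1 : DPath (levelOrientation T k) 1 (u, c) (r, true) :=
      arc_down hur.symm hr hi rfl
    cases d
    · exact h1.trans (h.dPath_r_b hr false)
    · exact h1.trans (h.arc_to_b hr true)

lemma dPath_from_b (h : IsLevelMap T k x p a b) (u : V) (d c : Bool) :
    DPath (levelOrientation T k) (lengthFrom (k u) d c) (b, d) (u, c) := by
  have hle := h.le_five u
  generalize hi : k u = i at hle
  interval_cases i
  · obtain rfl := (h.eq_zero u).1 hi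
    exact ((h.arc_ba d).trans (h.arc_from_a h.one_p (!c))).trans (h.arc_px c)
  · exact (h.arc_ba d).trans (h.arc_from_a hi c)
  · obtain rfl := (h.eq_two u).1 hi
    cases c
    · exact h.arc_ba d
    · exact (h.arc_ba d).trans h.dPath_a_a
  · obtain rfl := (h.eq_three u).1 hi
    by_cases hcd : c = d
    · subst hcd; simp [lengthFrom, DPath]
    · simpa [lengthFrom, hcd] using h.dPath_b_b d c
  · by_cases hcd : c = d
    · subst hcd; simpa [lengthFrom] using h.dPath_b_r hi c
    · obtain rfl : d = !c := Bool.eq_not_of_ne (Ne.symm hcd)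
      simpa [lengthFrom] using h.arc_from_b hi c
  · obtain ⟨r, hr, hur⟩ := h.exists_parent u hi
    have h1 : DPath (levelOrientation T k) 1 (r, false) (u, c) :=
      arc_up hur.symm hr hi rfl
    cases d
    · exact (h.dPath_b_r hr false).trans h1
    · exact (h.arc_from_b hr false).trans h1

lemma dPath_x_x (h : IsLevelMap T k x p a b) (c d : Bool) :
    ∃ m < 5, DPath (levelOrientation T k) (m + 1) (x, c) (x, d) := by
  have h1 (e : Bool) : DPath (levelOrientation T k) 2 (x, !e) (x, e) :=
    (h.arc_xp (!e)).trans (h.arc_px e)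
  by_cases hcd : c = d
  · subst hcd
    have h2 := h1 (!c)
    rw [Bool.not_not] at h2
    exact ⟨3, by norm_num, h2.trans (h1 c)⟩
  · obtain rfl : c = !d := Bool.eq_not_of_ne hcd
    exact ⟨1, by norm_num, h1 d⟩

lemma exists_lengthTo_add_lengthFrom_le : ∀ i ≤ 5, ∀ j ≤ 5, ∀ c e : Bool,
    (i = 0 ∧ j = 0) ∨ (i = 0 ∧ j = 2 ∧ e = true) ∨ (i = 2 ∧ j = 0 ∧ c = false) ∨
    (i = 2 ∧ j = 2 ∧ c = false ∧ e = true) ∨ (i = 3 ∧ j = 3) ∨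
    ∃ d : Bool, 0 < lengthTo i c d + lengthFrom j d e ∧ lengthTo i c d + lengthFrom j d e ≤ 5 := by
  intro i hi j hj
  interval_cases i <;> interval_cases j <;> decide

lemma exists_dPath (h : IsLevelMap T k x p a b) (u v : V × Bool) :
    ∃ m < 5, DPath (levelOrientation T k) (m + 1) u v := by
  obtain ⟨u, c⟩ := u
  obtain ⟨v, e⟩ := v
  rcases exists_lengthTo_add_lengthFrom_le (k u) (h.le_five u) (k v) (h.le_five v) c e with
    ⟨hu, hv⟩ | ⟨hu, hv, rfl⟩ | ⟨hu, hv, rfl⟩ | ⟨hu, hv, rfl, rfl⟩ | ⟨hu, hv⟩ | ⟨d, hpos, hle⟩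
  · obtain rfl := (h.eq_zero u).1 hu
    obtain rfl := (h.eq_zero v).1 hv
    exact h.dPath_x_x c e
  · obtain rfl := (h.eq_zero u).1 hu
    obtain rfl := (h.eq_two v).1 hv
    exact ⟨1, by norm_num, (h.arc_xp c).trans (h.arc_to_a h.one_p c)⟩
  · obtain rfl := (h.eq_two u).1 hu
    obtain rfl := (h.eq_zero v).1 hv
    exact ⟨1, by norm_num, (h.arc_from_a h.one_p (!e)).trans (h.arc_px e)⟩
  · obtain rfl := (h.eq_two u).1 hu
    obtain rfl := (h.eq_two v).1 hv
    exact ⟨1, by norm_num, h.dPath_a_a⟩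
  · obtain rfl := (h.eq_three u).1 hu
    obtain rfl := (h.eq_three v).1 hv
    exact ⟨3, by norm_num, h.dPath_b_b c e⟩
  · refine ⟨lengthTo (k u) c d + lengthFrom (k v) d e - 1, by omega, ?_⟩
    rw [Nat.sub_add_cancel hpos]
    exact (h.dPath_to_b u c d).trans (h.dPath_from_b v d e)

lemma orientNum_vertexMult_le (h : IsLevelMap T k x p a b) {s : V → ℕ} (hs : ∀ v, 2 ≤ s v) :
    orientNum (vertexMult T s) ≤ 5 := by
  let f : (Σ v, Fin (s v)) → V × Bool := fun y => (y.1, decide (y.2.val = 0))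
  have hf : Function.Surjective f := by
    rintro ⟨v, c⟩
    cases c
    · exact ⟨⟨v, 1, hs v⟩, rfl⟩
    · exact ⟨⟨v, 0, zero_lt_two.trans_le (hs v)⟩, rfl⟩
  let D : (Σ v, Fin (s v)) → (Σ v, Fin (s v)) → Prop :=
    fun y z => levelOrientation T k (f y) (f z)
  have hD (y z) : ∃ m < 5, DPath D (m + 1) y z := by
    obtain ⟨m, hm, hyz⟩ := h.exists_dPath (f y) (f z)
    exact ⟨m, hm, hyz.comap hf⟩
  have hstrong : IsStrongOrientation (vertexMult T s) D :=
    ⟨⟨fun _ _ huv => huv.1, fun _ _ huv => h.levelOrientation_iff_not huv⟩, fun y z =>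
      have ⟨m, _, hm⟩ := hD y z
      ⟨m + 1, hm⟩⟩
  refine le_trans (sInf_le ⟨D, hstrong, rfl⟩) (iSup₂_le fun y z => ?_)
  obtain ⟨m, hm, hyz⟩ := hD y z
  exact (ddist_le hyz).trans (by exact_mod_cast hm)

end IsLevelMap

lemma SimpleGraph.IsTree.exists_isLevelMap_of_ediam_eq_five [Finite V] {T : SimpleGraph V}
    (hT : T.IsTree) (hdiam : T.ediam = 5)
    (hA : {x : V | ∃ u v : V, u ≠ v ∧ T.edist x u = 5 ∧ T.edist x v = 5}.Subsingleton) :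
    ∃ k x p a b, IsLevelMap T k x p a b := by
  have hconn := hT.connected
  have hcoe (u v : V) : T.edist u v = T.dist u v := (hconn u v).coe_dist_eq_edist.symm
  have hle5 (u v : V) : T.dist u v ≤ 5 := by
    have : T.edist u v ≤ 5 := hdiam ▸ edist_le_ediam
    rw [hcoe] at this
    exact_mod_cast this
  have : Nonempty V := hconn.nonempty
  obtain ⟨x, y, hxy⟩ := T.exists_edist_eq_ediam_of_finite
  replace hxy : T.dist x y = 5 := by
    rw [hdiam, hcoe] at hxy
    exact_mod_cast hxy
  obtain ⟨w, hw⟩ := hconn.exists_walk_length_eq_dist x y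
  rw [hxy] at hw
  have hprefix (n : ℕ) (hn : n ≤ 5) :
      T.dist x (w.getVert n) = n ∧ T.dist y (w.getVert n) = 5 - n := by
    have h1 := dist_le (w.take n)
    have h2 := dist_le (w.drop n)
    have h3 := hconn.dist_triangle (u := x) (v := w.getVert n) (w := y)
    rw [Walk.take_length] at h1
    rw [Walk.drop_length] at h2
    rw [T.dist_comm (u := y)]
    omega
  have hab : T.Adj (w.getVert 2) (w.getVert 3) := w.adj_getVert_succ (by omega)
  obtain ⟨hxa, hya⟩ := hprefix 2 (by norm_num)
  obtain ⟨hxb, hyb⟩ := hprefix 3 (by norm_num)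
  generalize w.getVert 2 = a at hab hxa hya
  generalize w.getVert 3 = b at hab hxb hyb
  have ha (z) (hz : T.dist z a < T.dist z b) : T.dist z a ≤ 2 := by
    have := hT.dist_eq_of_adj hab hz (z := y) (by omega)
    have := hle5 z y
    omega
  have hb (z) (hz : T.dist z b < T.dist z a) : T.dist z b ≤ 2 := by
    have := hT.dist_eq_of_adj hab (w := x) (by omega) hz
    have := hle5 x z
    omega
  by_cases huniq : ∀ z, T.dist z a < T.dist z b → T.dist z a = 2 → z = x
  · obtain ⟨k, p, h⟩ := hT.exists_isLevelMap hab ha hb (by omega) hxa huniq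
    exact ⟨k, x, p, a, b, h⟩
  · push Not at huniq
    obtain ⟨x', hx', hx'a, hne⟩ := huniq
    have huniq' : ∀ z, T.dist z b < T.dist z a → T.dist z b = 2 → z = y := by
      intro z hz hzb
      by_contra hzy
      have h1 := hT.dist_eq_of_adj hab (w := x) (by omega) hz
      have h2 := hT.dist_eq_of_adj hab hx' (z := y) (by omega)
      have h3 := hT.dist_eq_of_adj hab hx' hz
      refine hne (hA ⟨y, z, Ne.symm hzy, ?_, ?_⟩ ⟨y, z, Ne.symm hzy, ?_, ?_⟩) <;>
        rw [hcoe] <;> norm_cast <;> omega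
    obtain ⟨k, p, h⟩ := hT.exists_isLevelMap hab.symm hb ha (by omega) hyb huniq'
    exact ⟨k, y, p, b, a, h⟩

theorem stmt4 [Fintype V] (T : SimpleGraph V) (hT : T.IsTree) (hdiam : T.ediam = 5)
    (s : V → ℕ) (hs : ∀ v, 2 ≤ s v)
    (hA : {x : V | ∃ u v : V, u ≠ v ∧ T.edist x u = 5 ∧ T.edist x v = 5}.Subsingleton) :
    orientNum (vertexMult T s) = 5 := by
  obtain ⟨k, x, p, a, b, h⟩ := hT.exists_isLevelMap_of_ediam_eq_five hdiam hA
  refine le_antisymm (h.orientNum_vertexMult_le hs) (le_sInf ?_)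
  rintro _ ⟨D, hD, rfl⟩
  exact hdiam ▸ hD.1.ediam_le_odiam fun v => zero_lt_two.trans_le (hs v)
end
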